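/- arXiv:2410.05098 — 2 statements merged into one kernel-verified Lean document; each statement's English description precedes it below -/
import Mathlib

section
/- There exists a constant C > 0, independent of the aperture half-width α, the wavenumber k, and the sampling points, such that for all α ∈ (0, π], all k > 0, and all z, y ∈ ℝ² with z ≠ y, the limited-aperture kernel satisfies |K_α(z,y)| ≤ C · k^{−3/2} · |y − z|^{−1/2}. -/
open MeasureTheory

/-- The 2-D far-field pattern of the free-space Green's function:
`G∞(z,θ) = (exp(iπ/4)/√(8kπ)) · exp(−i k (z₁ cos θ + z₂ sin θ))`. -/
noncomputable def Ginf (k : ℝ) (z : ℝ × ℝ) (θ : ℝ) : ℂ :=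
  (Complex.exp ((Real.pi : ℂ) * Complex.I / 4) / ((Real.sqrt (8 * k * Real.pi) : ℝ) : ℂ)) *
    Complex.exp (-(Complex.I * (k : ℂ) * ((z.1 * Real.cos θ + z.2 * Real.sin θ : ℝ) : ℂ)))

/-- The limited-aperture kernel `K_α(z,y) = ∫_{−α}^{α} G∞(z,θ) conj(G∞(y,θ)) dθ`. -/
noncomputable def Kker (k α : ℝ) (z y : ℝ × ℝ) : ℂ :=
  ∫ θ in (-α)..α, Ginf k z θ * (starRingEnd ℂ) (Ginf k y θ)

lemma aux_sin_lower (t : ℝ) (h1 : -(Real.pi/2) ≤ t) (h2 : t ≤ Real.pi/2) :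
    (2 / Real.pi * t)^2 ≤ Real.sin t ^ 2 := by
  have h := Real.mul_abs_le_abs_sin (abs_le.2 ⟨h1, h2⟩)
  have hp := Real.pi_pos
  rw [← sq_abs (Real.sin t), ← sq_abs (2 / Real.pi * t), abs_mul, abs_of_pos (by positivity : 0 < 2 / Real.pi)]
  exact pow_le_pow_left₀ (by positivity) h 2

lemma aux_cont (q : ℝ) (hq : 0 < q) : Continuous (fun t : ℝ => 1 / (Real.sin t ^ 2 + q ^ 2)) := by
  refine Continuous.div continuous_const (by fun_prop) (fun t => by positivity)

lemma aux_base (q : ℝ) (hq : 0 < q) :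
    ∫ t in (-(Real.pi/2))..(Real.pi/2), 1 / (Real.sin t ^ 2 + q ^ 2) ≤ Real.pi^2 / (2 * q) := by
  have hp := Real.pi_pos
  have hc : Continuous (fun t : ℝ => 1 / ((2 / Real.pi * t) ^ 2 + q ^ 2)) := by
    refine Continuous.div continuous_const (by fun_prop) (fun t => by positivity)
  have h1 : ∫ t in (-(Real.pi/2))..(Real.pi/2), 1 / (Real.sin t ^ 2 + q ^ 2) ≤
      ∫ t in (-(Real.pi/2))..(Real.pi/2), 1 / ((2 / Real.pi * t) ^ 2 + q ^ 2) := by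
    apply intervalIntegral.integral_mono_on (by linarith)
      ((aux_cont q hq).intervalIntegrable _ _) (hc.intervalIntegrable _ _)
    intro t ht
    have := aux_sin_lower t ht.1 ht.2
    apply one_div_le_one_div_of_le (by positivity)
    linarith
  have h2 : ∫ t in (-(Real.pi/2))..(Real.pi/2), 1 / ((2 / Real.pi * t) ^ 2 + q ^ 2) =
      Real.pi / (2 * q) * Real.arctan (2 / (Real.pi * q) * (Real.pi/2))
      - Real.pi / (2 * q) * Real.arctan (2 / (Real.pi * q) * (-(Real.pi/2))) := by
    apply intervalIntegral.integral_eq_sub_of_hasDerivAt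
      (f := fun t => Real.pi / (2 * q) * Real.arctan (2 / (Real.pi * q) * t))
    · intro t _
      have h := (((hasDerivAt_id t).const_mul (2 / (Real.pi * q))).arctan).const_mul (Real.pi / (2 * q))
      refine h.congr_deriv ?_
      simp only [id]
      field_simp
      ring
    · exact hc.intervalIntegrable _ _
  have h3 := Real.arctan_lt_pi_div_two (2 / (Real.pi * q) * (Real.pi/2))
  have h4 := Real.neg_pi_div_two_lt_arctan (2 / (Real.pi * q) * (-(Real.pi/2)))
  rw [h2] at h1
  refine h1.trans ?_
  rw [← mul_sub]
  have : Real.pi^2 / (2 * q) = Real.pi / (2 * q) * Real.pi := by ring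
  rw [this]
  apply mul_le_mul_of_nonneg_left _ (by positivity)
  linarith

lemma aux_H (q : ℝ) (hq : 0 < q) (a b : ℝ) (hab : a ≤ b) (hb : b ≤ a + 2 * Real.pi) :
    ∫ t in a..b, 1 / (Real.sin t ^ 2 + q ^ 2) ≤ Real.pi^2 / q := by
  have hp := Real.pi_pos
  have hi : ∀ x y, IntervalIntegrable (fun t : ℝ => 1 / (Real.sin t ^ 2 + q ^ 2)) volume x y :=
    fun x y => (aux_cont q hq).intervalIntegrable _ _
  have hper : Function.Periodic (fun t : ℝ => 1 / (Real.sin t ^ 2 + q ^ 2)) Real.pi := by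
    intro t
    simp [Real.sin_add_pi]
  have key : ∀ x, ∫ t in x..(x + Real.pi), 1 / (Real.sin t ^ 2 + q ^ 2) ≤ Real.pi^2 / (2 * q) := by
    intro x
    have h := hper.intervalIntegral_add_eq x (-(Real.pi/2))
    rw [h]
    have : -(Real.pi/2) + Real.pi = Real.pi/2 := by ring
    rw [this]
    exact aux_base q hq
  have h1 : ∫ t in a..b, 1 / (Real.sin t ^ 2 + q ^ 2) ≤
      ∫ t in a..(a + Real.pi + Real.pi), 1 / (Real.sin t ^ 2 + q ^ 2) := by
    apply intervalIntegral.integral_mono_interval le_rfl hab (by linarith) _ (hi _ _)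
    exact Filter.Eventually.of_forall (fun t => by simp only [Pi.zero_apply]; positivity)
  rw [← intervalIntegral.integral_add_adjacent_intervals (hi a (a + Real.pi))
    (hi _ (a + Real.pi + Real.pi))] at h1
  have := key a
  have := key (a + Real.pi)
  have h5 : Real.pi^2 / q = Real.pi^2 / (2 * q) + Real.pi^2 / (2 * q) := by
    field_simp; ring
  linarith

lemma aux_normE (q t : ℝ) :
    ‖Complex.exp (Complex.I * ((Real.cos t / q ^ 2 : ℝ) : ℂ))‖ = 1 := by
  rw [mul_comm]; exact Complex.norm_exp_ofReal_mul_I _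

lemma aux_g (q : ℝ) (hq : 0 < q) (t : ℝ) :
    |Real.sin t / (Real.sin t ^ 2 + q ^ 2)| ≤ 1 / (2 * q) := by
  rw [abs_div, abs_of_pos (by positivity : 0 < Real.sin t ^ 2 + q ^ 2),
    div_le_div_iff₀ (by positivity) (by positivity), ← sq_abs (Real.sin t)]
  nlinarith [sq_nonneg (|Real.sin t| - q)]

lemma aux_main (q : ℝ) (hq : 0 < q) (a b : ℝ) (hab : a ≤ b) (hb : b ≤ a + 2 * Real.pi) :
    ‖∫ t in a..b, Complex.exp (Complex.I * ((Real.cos t / q ^ 2 : ℝ) : ℂ))‖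
      ≤ (1 + 2 * Real.pi ^ 2) * q := by
  set E : ℝ → ℂ := fun t => Complex.exp (Complex.I * ((Real.cos t / q ^ 2 : ℝ) : ℂ)) with hE
  set h : ℝ → ℝ := fun t => 1 / (Real.sin t ^ 2 + q ^ 2) with hh
  set g : ℝ → ℝ := fun t => Real.sin t / (Real.sin t ^ 2 + q ^ 2) with hg
  set g' : ℝ → ℝ := fun t => Real.cos t * (q ^ 2 - Real.sin t ^ 2) / (Real.sin t ^ 2 + q ^ 2) ^ 2 with hg'
  have hEc : Continuous E := by
    simp only [hE]; fun_prop
  have hhc : Continuous h := aux_cont q hq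
  have hgc : Continuous g :=
    Continuous.div (by fun_prop) (by fun_prop) (fun t => by positivity)
  have hg'c : Continuous g' :=
    Continuous.div (by fun_prop) (by fun_prop) (fun t => by positivity)
  have hdE : ∀ t, HasDerivAt E (E t * (Complex.I * ((-Real.sin t / q ^ 2 : ℝ) : ℂ))) t := by
    intro t
    exact ((((Real.hasDerivAt_cos t).div_const (q^2)).ofReal_comp).const_mul Complex.I).cexp
  have hdg : ∀ t, HasDerivAt g (g' t) t := by
    intro t
    have h0 : Real.sin t ^ 2 + q ^ 2 ≠ 0 := by positivity
    have := (Real.hasDerivAt_sin t).div ((((Real.hasDerivAt_sin t).pow 2)).add_const (q^2)) h0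
    refine this.congr_deriv ?_
    simp only [hg', Pi.pow_apply]
    push_cast
    ring
  have hFTC : ∫ t in a..b, ((g' t : ℂ) * E t + (g t : ℂ) * (E t * (Complex.I * ((-Real.sin t / q ^ 2 : ℝ) : ℂ))))
      = (g b : ℂ) * E b - (g a : ℂ) * E a := by
    apply intervalIntegral.integral_eq_sub_of_hasDerivAt (f := fun t => (g t : ℂ) * E t)
    · intro t _
      exact ((hdg t).ofReal_comp).mul (hdE t)
    · apply Continuous.intervalIntegrable
      fun_prop
  -- pointwise identity
  have hpt : ∀ t, E t = (Complex.I * (q:ℂ) ^ 2) * ((g' t : ℂ) * E t + (g t : ℂ) * (E t * (Complex.I * ((-Real.sin t / q ^ 2 : ℝ) : ℂ))))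
      + ((q:ℂ)^2 * (h t : ℂ) * E t - (Complex.I * (q:ℂ) ^ 2) * ((g' t : ℂ) * E t)) := by
    intro t
    have h0 : Real.sin t ^ 2 + q ^ 2 ≠ 0 := by positivity
    have h1 : Real.sin t * g t + q ^ 2 * h t = 1 := by
      simp only [hg, hh]; field_simp
    have h2 : (Real.sin t : ℂ) * (g t : ℂ) + (q:ℂ) ^ 2 * (h t : ℂ) = 1 := by exact_mod_cast h1
    have hqc : (q : ℂ) ≠ 0 := by exact_mod_cast hq.ne'
    have h3 : (q:ℂ)^2 * ((-Real.sin t / q ^ 2 : ℝ) : ℂ) = -(Real.sin t : ℂ) := by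
      push_cast; field_simp
    linear_combination (-E t) * h2 - (g t : ℂ) * E t * Complex.I ^ 2 * h3 + (g t : ℂ) * E t * (Real.sin t : ℂ) * Complex.I_sq
  have hint : ∫ t in a..b, E t = (Complex.I * (q:ℂ) ^ 2) * ((g b : ℂ) * E b - (g a : ℂ) * E a)
      + ∫ t in a..b, ((q:ℂ)^2 * (h t : ℂ) * E t - (Complex.I * (q:ℂ) ^ 2) * ((g' t : ℂ) * E t)) := by
    rw [← hFTC, ← intervalIntegral.integral_const_mul, ← intervalIntegral.integral_add]
    · exact intervalIntegral.integral_congr (fun t _ => hpt t)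
    · apply Continuous.intervalIntegrable
      fun_prop
    · apply Continuous.intervalIntegrable
      fun_prop
  have hnE : ∀ t, ‖E t‖ = 1 := aux_normE q
  have hg'b : ∀ t, |g' t| ≤ h t := by
    intro t
    have h0 : 0 < Real.sin t ^ 2 + q ^ 2 := by positivity
    simp only [hg', hh]
    rw [abs_div, abs_of_pos (by positivity : 0 < (Real.sin t ^ 2 + q ^ 2)^2), abs_mul,
      div_le_div_iff₀ (by positivity) h0]
    have h1 := Real.abs_cos_le_one t
    have h2 : |q ^ 2 - Real.sin t ^ 2| ≤ Real.sin t ^ 2 + q ^ 2 := by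
      rw [abs_le]; constructor <;> nlinarith [sq_nonneg q, sq_nonneg (Real.sin t)]
    have h3 : |Real.cos t| * |q ^ 2 - Real.sin t ^ 2| ≤ 1 * (Real.sin t ^ 2 + q ^ 2) :=
      mul_le_mul h1 h2 (abs_nonneg _) zero_le_one
    nlinarith
  have hB : ‖∫ t in a..b, ((q:ℂ)^2 * (h t : ℂ) * E t - (Complex.I * (q:ℂ) ^ 2) * ((g' t : ℂ) * E t))‖
      ≤ ∫ t in a..b, 2 * q ^ 2 * h t := by
    apply intervalIntegral.norm_integral_le_of_norm_le hab
    · refine Filter.Eventually.of_forall (fun t _ => ?_)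
      refine (norm_sub_le _ _).trans ?_
      have hpos : 0 ≤ h t := by simp only [hh]; positivity
      simp only [norm_mul, norm_pow, hnE, Complex.norm_I, Complex.norm_real, Real.norm_eq_abs,
        abs_of_pos hq, abs_of_nonneg hpos]
      nlinarith [hg'b t, sq_nonneg q]
    · apply Continuous.intervalIntegrable
      fun_prop
  rw [intervalIntegral.integral_const_mul] at hB
  have hH : ∫ t in a..b, h t ≤ Real.pi^2 / q := aux_H q hq a b hab hb
  have hA : ‖(Complex.I * (q:ℂ) ^ 2) * ((g b : ℂ) * E b - (g a : ℂ) * E a)‖ ≤ q ^ 2 * (1 / (2*q) + 1 / (2*q)) := by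
    rw [norm_mul]
    have e : ‖Complex.I * (q:ℂ) ^ 2‖ = q ^ 2 := by
      simp [abs_of_pos hq]
    rw [e]
    apply mul_le_mul_of_nonneg_left _ (by positivity)
    refine (norm_sub_le _ _).trans ?_
    simp only [norm_mul, hnE, Complex.norm_real, Real.norm_eq_abs, mul_one]
    exact add_le_add (aux_g q hq b) (aux_g q hq a)
  rw [hint]
  refine (norm_add_le _ _).trans ?_
  have h7 : 2 * q ^ 2 * ∫ t in a..b, h t ≤ 2 * q ^ 2 * (Real.pi^2 / q) :=
    mul_le_mul_of_nonneg_left hH (by positivity)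
  have h8 : q ^ 2 * (1 / (2*q) + 1 / (2*q)) + 2 * q ^ 2 * (Real.pi^2 / q) = (1 + 2 * Real.pi ^ 2) * q := by
    field_simp; ring
  linarith

/-- Decay estimate for the limited-aperture kernel:
`|K_α(z,y)| ≤ C k^{−3/2} |y−z|^{−1/2}` with a constant `C` independent of `α`, `k` and the
sampling points, where `|y−z|` denotes the Euclidean distance. -/
theorem limitedAperture_kernel_decay :
    ∃ C > 0, ∀ α ∈ Set.Ioc 0 Real.pi, ∀ k : ℝ, 0 < k → ∀ z y : ℝ × ℝ, z ≠ y →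
      ‖Kker k α z y‖ ≤
        C * k ^ (-(3 : ℝ)/2) * (Real.sqrt ((y.1 - z.1) ^ 2 + (y.2 - z.2) ^ 2)) ^ (-(1 : ℝ)/2) := by
  have hp := Real.pi_pos
  refine ⟨(1 + 2 * Real.pi ^ 2) / (8 * Real.pi), by positivity, ?_⟩
  rintro α ⟨hα0, hα⟩ k hk z y hzy
  set w : ℂ := ⟨y.1 - z.1, y.2 - z.2⟩ with hw
  have hw0 : w ≠ 0 := by
    intro h
    apply hzy
    have h1 := congrArg Complex.re h
    have h2 := congrArg Complex.im h
    simp only [hw, Complex.zero_re, Complex.zero_im] at h1 h2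
    exact Prod.ext (by linarith) (by linarith)
  have hR : Real.sqrt ((y.1 - z.1) ^ 2 + (y.2 - z.2) ^ 2) = ‖w‖ := by
    rw [Complex.norm_eq_sqrt_sq_add_sq]
  rw [hR]
  have hRpos : 0 < ‖w‖ := norm_pos_iff.2 hw0
  set R := ‖w‖ with hRdef
  set φ := Complex.arg w with hφ
  have hc : R * Real.cos φ = y.1 - z.1 := Complex.norm_mul_cos_arg w
  have hs : R * Real.sin φ = y.2 - z.2 := Complex.norm_mul_sin_arg w
  set q : ℝ := (k * R) ^ (-(1:ℝ)/2) with hqdef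
  have hkR : 0 < k * R := by positivity
  have hq : 0 < q := Real.rpow_pos_of_pos hkR _
  have hq2 : q ^ 2 = (k * R)⁻¹ := by
    rw [hqdef, ← Real.rpow_natCast, ← Real.rpow_mul hkR.le]
    norm_num
    rw [Real.rpow_neg_one]
    ring
  have hpt : ∀ θ : ℝ, Ginf k z θ * (starRingEnd ℂ) (Ginf k y θ) =
      ((1 / (8 * k * Real.pi) : ℝ) : ℂ) *
        Complex.exp (Complex.I * ((Real.cos (θ - φ) / q ^ 2 : ℝ) : ℂ)) := by
    intro θ
    have e1 : Real.cos (θ - φ) / q ^ 2 =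
        k * ((y.1 * Real.cos θ + y.2 * Real.sin θ) - (z.1 * Real.cos θ + z.2 * Real.sin θ)) := by
      rw [hq2, div_inv_eq_mul, Real.cos_sub]
      linear_combination k * Real.cos θ * hc + k * Real.sin θ * hs
    rw [e1]
    unfold Ginf
    have hsq : ((Real.sqrt (8 * k * Real.pi) : ℝ) : ℂ) * ((Real.sqrt (8 * k * Real.pi) : ℝ) : ℂ)
        = ((8 * k * Real.pi : ℝ) : ℂ) := by
      rw [← Complex.ofReal_mul, Real.mul_self_sqrt (by positivity)]
    set P : ℝ := z.1 * Real.cos θ + z.2 * Real.sin θ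
    set Q : ℝ := y.1 * Real.cos θ + y.2 * Real.sin θ
    simp only [map_mul, map_div₀, ← Complex.exp_conj, Complex.conj_ofReal, Complex.conj_I, map_neg,
      map_ofNat]
    have e2 : ∀ A B S C D : ℂ, A / S * B * (C / S * D) = (A * C) * (B * D) / (S * S) := by
      intros; ring
    rw [e2, hsq, ← Complex.exp_add, ← Complex.exp_add]
    have e3 : (Real.pi : ℂ) * Complex.I / 4 + (Real.pi : ℂ) * -Complex.I / 4 = 0 := by ring
    rw [e3, Complex.exp_zero, one_mul, Complex.ofReal_div, Complex.ofReal_one, div_eq_mul_one_div, mul_comm]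
    congr 2
    push_cast
    ring
  unfold Kker
  simp_rw [hpt]
  rw [intervalIntegral.integral_const_mul, norm_mul,
    intervalIntegral.integral_comp_sub_right
      (fun t => Complex.exp (Complex.I * ((Real.cos t / q ^ 2 : ℝ) : ℂ))) φ]
  have hm := aux_main q hq (-α - φ) (α - φ) (by linarith) (by linarith)
  rw [Complex.norm_real, Real.norm_eq_abs, abs_of_pos (by positivity)]
  refine (mul_le_mul_of_nonneg_left hm (by positivity)).trans (le_of_eq ?_)
  have hk3 : k ^ (-(3:ℝ)/2) = k⁻¹ * k ^ (-(1:ℝ)/2) := by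
    rw [← Real.rpow_neg_one k, ← Real.rpow_add hk]
    norm_num
  rw [hk3, hqdef, Real.mul_rpow hk.le hRpos.le]
  field_simp
end

section
/- There exists a constant C > 0 with the following property: for every α ∈ (0, π], every β ∈ [−π, π], and every ρ ≥ 1, setting δ = ρ^{−1/2} and Q_δ = { θ ∈ (−π, π) : |(α/π)θ − β − mπ| < δ for some m ∈ {−1, 0, 1} }, one has | ∫_{(−π,π) \setminus Q_δ} exp( i ρ cos( (α/π) θ − β ) ) dθ | ≤ C · α^{−1} · ρ^{−1/2}. (This is the bound away from the stationary-phase set used in the proof of the decay estimate for the limited-aperture kernel; the constant C does not depend on α, β, or ρ.) -/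
open MeasureTheory

noncomputable def oscF (r u : ℝ) : ℂ := Complex.exp (Complex.I * (r : ℂ) * ((Real.cos u : ℝ) : ℂ))

lemma oscF_cont (r : ℝ) : Continuous (oscF r) := by
  unfold oscF; fun_prop

lemma oscF_norm (r u : ℝ) : ‖oscF r u‖ = 1 := by
  unfold oscF
  have : Complex.I * (r : ℂ) * ((Real.cos u : ℝ) : ℂ) = ((r * Real.cos u : ℝ) : ℂ) * Complex.I := by
    push_cast; ring
  rw [this, Complex.norm_exp_ofReal_mul_I]

lemma oscF_int (r a b : ℝ) : IntervalIntegrable (oscF r) volume a b :=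
  (oscF_cont r).intervalIntegrable a b

lemma oscF_triv (r a b : ℝ) : ‖∫ u in a..b, oscF r u‖ ≤ |b - a| := by
  have := intervalIntegral.norm_integral_le_of_norm_le_const (a := a) (b := b) (C := 1)
    (f := oscF r) (fun x _ => (oscF_norm r x).le)
  simpa using this

lemma oscF_hasDeriv (r u : ℝ) (hr : r ≠ 0) (hs : Real.sin u ≠ 0) :
    HasDerivAt (fun u : ℝ => oscF r u * (Complex.I / r * (((Real.sin u)⁻¹ : ℝ) : ℂ)))
      (oscF r u - Complex.I / r * (oscF r u * ((Real.cos u / (Real.sin u) ^ 2 : ℝ) : ℂ))) u := by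
  have h1 : HasDerivAt (fun u : ℝ => ((Real.cos u : ℝ) : ℂ)) ((-Real.sin u : ℝ) : ℂ) u :=
    (Real.hasDerivAt_cos u).ofReal_comp
  have h2 := (h1.const_mul (Complex.I * (r : ℂ))).cexp
  have h3 : HasDerivAt (fun u : ℝ => (((Real.sin u)⁻¹ : ℝ) : ℂ))
      ((-Real.cos u / (Real.sin u) ^ 2 : ℝ) : ℂ) u :=
    ((Real.hasDerivAt_sin u).inv hs).ofReal_comp
  have h4 := h2.mul (h3.const_mul (Complex.I / r))
  refine h4.congr_deriv ?_
  have hr' : (r : ℂ) ≠ 0 := by exact_mod_cast hr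
  have hs' : Complex.sin u ≠ 0 := by
    rw [← Complex.ofReal_sin]; exact_mod_cast hs
  unfold oscF
  push_cast
  field_simp
  linear_combination (-(r : ℂ) * Complex.sin u ^ 2) * Complex.I_sq

lemma oscF_vdc (r a b : ℝ) (hr : r ≠ 0) (ha : 0 < a) (hab : a ≤ b) (hb : b ≤ Real.pi / 2) :
    ‖∫ u in a..b, oscF r u‖ ≤ 2 / (|r| * Real.sin a) := by
  have hpi := Real.pi_pos
  have hsin : ∀ u ∈ Set.uIcc a b, 0 < Real.sin u := by
    intro u hu
    rw [Set.uIcc_of_le hab] at hu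
    exact Real.sin_pos_of_pos_of_lt_pi (by linarith [hu.1]) (by linarith [hu.2])
  have hgc : ContinuousOn (fun u : ℝ => Real.cos u / (Real.sin u) ^ 2) (Set.uIcc a b) := by
    apply ContinuousOn.div (by fun_prop) (by fun_prop)
    intro u hu
    exact pow_ne_zero _ (hsin u hu).ne'
  have hg : IntervalIntegrable (fun u : ℝ => Real.cos u / (Real.sin u) ^ 2) volume a b :=
    hgc.intervalIntegrable
  have hF : IntervalIntegrable (fun u : ℝ => Complex.I / r * (oscF r u *
      ((Real.cos u / (Real.sin u) ^ 2 : ℝ) : ℂ))) volume a b := by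
    apply ContinuousOn.intervalIntegrable
    exact continuousOn_const.mul ((oscF_cont r).continuousOn.mul
      (Complex.continuous_ofReal.comp_continuousOn hgc))
  have key := intervalIntegral.integral_eq_sub_of_hasDerivAt
    (fun u hu => oscF_hasDeriv r u hr (hsin u hu).ne') ((oscF_int r a b).sub hF)
  rw [intervalIntegral.integral_sub (oscF_int r a b) hF, intervalIntegral.integral_const_mul] at key
  have hreal : ∫ u in a..b, Real.cos u / (Real.sin u) ^ 2 = (Real.sin a)⁻¹ - (Real.sin b)⁻¹ := by
    have := intervalIntegral.integral_eq_sub_of_hasDerivAt (a := a) (b := b)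
      (f := fun u => -(Real.sin u)⁻¹) (f' := fun u => Real.cos u / (Real.sin u) ^ 2)
      (fun u hu => by
        have := ((Real.hasDerivAt_sin u).inv (hsin u hu).ne').neg
        refine this.congr_deriv ?_
        ring) hg
    rw [this]; ring
  have hrem : ‖∫ u in a..b, oscF r u * ((Real.cos u / (Real.sin u) ^ 2 : ℝ) : ℂ)‖
      ≤ (Real.sin a)⁻¹ - (Real.sin b)⁻¹ := by
    rw [← hreal]
    apply intervalIntegral.norm_integral_le_of_norm_le hab _ hg
    refine Filter.Eventually.of_forall fun u hu => ?_
    rw [norm_mul, oscF_norm, one_mul, Complex.norm_real, Real.norm_eq_abs, abs_of_nonneg]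
    have : 0 ≤ Real.cos u := Real.cos_nonneg_of_mem_Icc ⟨by linarith [hu.1], by linarith [hu.2]⟩
    positivity
  have hsa := hsin a (by simp)
  have hsb := hsin b (by simp)
  have hnr : ‖Complex.I / (r : ℂ)‖ = |r|⁻¹ := by simp
  have hr0 : 0 < |r| := abs_pos.mpr hr
  have hn : ∀ u, 0 < Real.sin u → ‖oscF r u * (Complex.I / r * (((Real.sin u)⁻¹ : ℝ) : ℂ))‖
      = |r|⁻¹ * (Real.sin u)⁻¹ := by
    intro u hu
    rw [norm_mul, norm_mul, oscF_norm, hnr, Complex.norm_real, Real.norm_eq_abs,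
      abs_of_pos (inv_pos.mpr hu), one_mul]
  rw [sub_eq_iff_eq_add] at key
  rw [key]
  refine (norm_add_le _ _).trans ?_
  refine (add_le_add (norm_sub_le _ _) le_rfl).trans ?_
  rw [hn a hsa, hn b hsb, norm_mul, hnr]
  have h5 := mul_le_mul_of_nonneg_left hrem (inv_pos.mpr hr0).le
  have : 2 / (|r| * Real.sin a) = |r|⁻¹ * (Real.sin b)⁻¹ + |r|⁻¹ * (Real.sin a)⁻¹
      + |r|⁻¹ * ((Real.sin a)⁻¹ - (Real.sin b)⁻¹) := by
    field_simp; ring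
  rw [this]
  linarith

/-- Bound on `[0, π/2]`. -/
lemma oscF_quarter (r d x : ℝ) (hd : 0 < d) (hrd : |r| * d ^ 2 = 1)
    (hx0 : 0 ≤ x) (hx : x ≤ Real.pi / 2) : ‖∫ u in (0 : ℝ)..x, oscF r u‖ ≤ 5 * d := by
  rcases le_total x d with h | h
  · refine (oscF_triv r 0 x).trans ?_
    rw [sub_zero, abs_of_nonneg hx0]; linarith
  · have hr : r ≠ 0 := by rintro rfl; simp at hrd
    have hr0 : 0 < |r| := abs_pos.mpr hr
    have hpi := Real.pi_pos
    rw [← intervalIntegral.integral_add_adjacent_intervals (oscF_int r 0 d) (oscF_int r d x)]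
    refine (norm_add_le _ _).trans ?_
    have h1 := oscF_triv r 0 d
    rw [sub_zero, abs_of_pos hd] at h1
    have h2 := oscF_vdc r d x hr hd h hx
    have h3 : 2 / Real.pi * d ≤ Real.sin d := Real.mul_le_sin hd.le (by linarith)
    have h4 : 2 / (|r| * Real.sin d) ≤ 4 * d := by
      have hs : 0 < Real.sin d := lt_of_lt_of_le (by positivity) h3
      rw [div_le_iff₀ (by positivity)]
      have h6 : 1 / 2 * d ≤ Real.sin d := by
        refine le_trans ?_ h3
        have : 1 / 2 ≤ 2 / Real.pi := by
          rw [div_le_div_iff₀ (by norm_num) hpi]; linarith [Real.pi_le_four]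
        gcongr
      calc (2 : ℝ) = 4 * d * (|r| * (1 / 2 * d)) := by linear_combination (-2) * hrd
        _ ≤ _ := by gcongr
    linarith

lemma oscF_half (r d x : ℝ) (hd : 0 < d) (hrd : |r| * d ^ 2 = 1)
    (hx0 : 0 ≤ x) (hx : x ≤ Real.pi) : ‖∫ u in (0 : ℝ)..x, oscF r u‖ ≤ 15 * d := by
  rcases le_total x (Real.pi / 2) with h | h
  · linarith [oscF_quarter r d x hd hrd hx0 h]
  · have hpi := Real.pi_pos
    rw [← intervalIntegral.integral_add_adjacent_intervals (oscF_int r 0 (Real.pi / 2))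
      (oscF_int r (Real.pi / 2) x)]
    have h1 := oscF_quarter r d (Real.pi / 2) hd hrd (by linarith) le_rfl
    have h2 : ∫ u in (Real.pi / 2)..x, oscF r u
        = ∫ u in (Real.pi - x)..(Real.pi / 2), oscF (-r) u := by
      have := intervalIntegral.integral_comp_sub_left (a := Real.pi / 2) (b := x)
        (oscF (-r)) Real.pi
      rw [show Real.pi - Real.pi / 2 = Real.pi / 2 by ring] at this
      rw [← this]
      congr 1; ext u
      simp [oscF]
    have h3 := intervalIntegral.integral_interval_sub_left (oscF_int (-r) 0 (Real.pi / 2))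
      (oscF_int (-r) 0 (Real.pi - x))
    rw [h2, ← h3]
    have hrd' : |-r| * d ^ 2 = 1 := by rwa [abs_neg]
    have h4 := oscF_quarter (-r) d (Real.pi / 2) hd hrd' (by linarith) le_rfl
    have h5 := oscF_quarter (-r) d (Real.pi - x) hd hrd' (by linarith) (by linarith)
    refine (norm_add_le _ _).trans ?_
    have h6 := norm_sub_le (∫ u in (0 : ℝ)..(Real.pi / 2), oscF (-r) u)
      (∫ u in (0 : ℝ)..(Real.pi - x), oscF (-r) u)
    linarith

lemma oscF_full (r d x : ℝ) (hd : 0 < d) (hrd : |r| * d ^ 2 = 1)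
    (hx0 : 0 ≤ x) (hx : x ≤ 2 * Real.pi) : ‖∫ u in (0 : ℝ)..x, oscF r u‖ ≤ 45 * d := by
  rcases le_total x Real.pi with h | h
  · linarith [oscF_half r d x hd hrd hx0 h]
  · have hpi := Real.pi_pos
    rw [← intervalIntegral.integral_add_adjacent_intervals (oscF_int r 0 Real.pi)
      (oscF_int r Real.pi x)]
    have h1 := oscF_half r d Real.pi hd hrd (by linarith) le_rfl
    have h2 : ∫ u in Real.pi..x, oscF r u
        = ∫ u in (2 * Real.pi - x)..Real.pi, oscF r u := by
      have := intervalIntegral.integral_comp_sub_left (a := Real.pi) (b := x)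
        (oscF r) (2 * Real.pi)
      rw [show 2 * Real.pi - Real.pi = Real.pi by ring] at this
      rw [← this]
      congr 1; ext u
      simp [oscF, Real.cos_two_pi_sub]
    have h3 := intervalIntegral.integral_interval_sub_left (oscF_int r 0 Real.pi)
      (oscF_int r 0 (2 * Real.pi - x))
    rw [h2, ← h3]
    have h5 := oscF_half r d (2 * Real.pi - x) hd hrd (by linarith) (by linarith)
    refine (norm_add_le _ _).trans ?_
    have h6 := norm_sub_le (∫ u in (0 : ℝ)..Real.pi, oscF r u)
      (∫ u in (0 : ℝ)..(2 * Real.pi - x), oscF r u)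
    linarith

lemma oscF_all (r d x : ℝ) (hd : 0 < d) (hrd : |r| * d ^ 2 = 1)
    (hx : |x| ≤ 2 * Real.pi) : ‖∫ u in (0 : ℝ)..x, oscF r u‖ ≤ 45 * d := by
  rcases le_total 0 x with h | h
  · rw [abs_of_nonneg h] at hx
    exact oscF_full r d x hd hrd h hx
  · rw [abs_of_nonpos h] at hx
    have h2 := intervalIntegral.integral_comp_neg (a := 0) (b := x) (oscF r)
    have h3 : ∫ u in (0 : ℝ)..x, oscF r (-u) = ∫ u in (0 : ℝ)..x, oscF r u := by
      congr 1; ext u; simp [oscF]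
    rw [← h3, h2, intervalIntegral.integral_symm, norm_neg, neg_zero]
    exact oscF_full r d (-x) hd hrd (by linarith) hx

/-- Stationary-phase bound away from the critical set: there is a constant `C > 0`, independent
of the aperture half-width `α ∈ (0,π]`, the direction angle `β ∈ [−π,π]` and `ρ ≥ 1`, such that
with `δ = ρ^{−1/2}` and `Q_δ` the set of `θ ∈ (−π,π)` with `(α/π)θ − β` within `δ` of `mπ`
for some `m ∈ {−1,0,1}`, one has
`|∫_{(−π,π)∖Q_δ} e^{iρ cos((α/π)θ − β)} dθ| ≤ C α⁻¹ ρ^{−1/2}`. -/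
theorem oscillatory_bound_away_from_stationary_set :
    ∃ C > 0, ∀ α ∈ Set.Ioc 0 Real.pi, ∀ β ∈ Set.Icc (-Real.pi) Real.pi, ∀ ρ : ℝ, 1 ≤ ρ →
      ‖∫ θ in (Set.Ioo (-Real.pi) Real.pi \
          {θ : ℝ | ∃ m ∈ ({-1, 0, 1} : Set ℤ),
            |α / Real.pi * θ - β - (m : ℝ) * Real.pi| < ρ ^ (-(1 : ℝ)/2)}),
          Complex.exp (Complex.I * (ρ : ℂ) *
            ((Real.cos (α / Real.pi * θ - β) : ℝ) : ℂ))‖ ≤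
        C * α⁻¹ * ρ ^ (-(1 : ℝ)/2) := by
  have hpi := Real.pi_pos
  refine ⟨96 * Real.pi, by positivity, ?_⟩
  intro α hα β hβ ρ hρ
  have hα0 : 0 < α := hα.1
  have hρ0 : 0 < ρ := by linarith
  set d : ℝ := ρ ^ (-(1 : ℝ)/2) with hddef
  have hd : 0 < d := Real.rpow_pos_of_pos hρ0 _
  have hrd : |ρ| * d ^ 2 = 1 := by
    rw [abs_of_pos hρ0, hddef, ← Real.rpow_natCast, ← Real.rpow_mul hρ0.le]
    norm_num [Real.rpow_neg_one]
    exact mul_inv_cancel₀ hρ0.ne'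
  set Q : Set ℝ := {θ : ℝ | ∃ m ∈ ({-1, 0, 1} : Set ℤ),
            |α / Real.pi * θ - β - (m : ℝ) * Real.pi| < d} with hQ
  have hfun : (fun θ : ℝ => Complex.exp (Complex.I * (ρ : ℂ) *
            ((Real.cos (α / Real.pi * θ - β) : ℝ) : ℂ)))
      = fun θ => oscF ρ (α / Real.pi * θ - β) := rfl
  rw [hfun]
  have hcont : Continuous fun θ => oscF ρ (α / Real.pi * θ - β) :=
    (oscF_cont ρ).comp (by fun_prop)
  let B : ℝ → Set ℝ := fun m =>
    Metric.ball ((β + m * Real.pi) * (Real.pi / α)) (d * (Real.pi / α))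
  have hB : ∀ m : ℝ, ∀ θ : ℝ, |α / Real.pi * θ - β - m * Real.pi| < d ↔ θ ∈ B m := by
    intro m θ
    have hk : 0 < Real.pi / α := by positivity
    rw [Metric.mem_ball, Real.dist_eq]
    have : θ - (β + m * Real.pi) * (Real.pi / α)
        = (α / Real.pi * θ - β - m * Real.pi) * (Real.pi / α) := by
      field_simp; ring
    rw [this, abs_mul, abs_of_pos hk]
    exact (mul_lt_mul_iff_left₀ hk).symm
  have hQB : Q = B (-1) ∪ (B 0 ∪ B 1) := by
    ext θ
    simp only [hQ, Set.mem_setOf_eq, hB, Set.mem_union]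
    simp
  have hQm : MeasurableSet Q := by
    rw [hQB]
    exact measurableSet_ball.union (measurableSet_ball.union measurableSet_ball)
  have hBv : ∀ m, volume.real (B m) = 2 * (d * (Real.pi / α)) := by
    intro m
    exact Real.volume_real_ball (by positivity)
  have hBf : ∀ m, volume (B m) ≠ ⊤ := fun m => measure_ball_lt_top.ne
  have hQf : volume Q ≠ ⊤ := by
    rw [hQB]
    exact measure_union_ne_top (hBf _) (measure_union_ne_top (hBf _) (hBf _))
  have hQv : volume.real Q ≤ 6 * (d * (Real.pi / α)) := by
    rw [hQB]
    have h1 := measureReal_union_le (μ := volume) (B (-1)) (B 0 ∪ B 1)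
    have h2 := measureReal_union_le (μ := volume) (B 0) (B 1)
    rw [hBv] at h1
    rw [hBv, hBv] at h2
    linarith
  have hint : IntegrableOn (fun θ => oscF ρ (α / Real.pi * θ - β))
      (Set.Ioo (-Real.pi) Real.pi) volume :=
    (hcont.integrableOn_Icc).mono_set Set.Ioo_subset_Icc_self
  have hsplit := integral_inter_add_diff hQm hint
  have hI : ∫ θ in Set.Ioo (-Real.pi) Real.pi, oscF ρ (α / Real.pi * θ - β)
      = (Real.pi / α : ℝ) • ((∫ u in (0 : ℝ)..(α - β), oscF ρ u)
        - ∫ u in (0 : ℝ)..(-α - β), oscF ρ u) := by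
    rw [← integral_Ioc_eq_integral_Ioo, ← intervalIntegral.integral_of_le (by linarith),
      intervalIntegral.integral_comp_mul_sub _ (by positivity : α / Real.pi ≠ 0),
      intervalIntegral.integral_interval_sub_left (oscF_int _ _ _) (oscF_int _ _ _)]
    have e1 : α / Real.pi * Real.pi = α := by field_simp
    have e2 : α / Real.pi * -Real.pi = -α := by field_simp
    rw [e1, e2, inv_div]
  have hE : ‖∫ θ in Set.Ioo (-Real.pi) Real.pi ∩ Q, oscF ρ (α / Real.pi * θ - β)‖
      ≤ 6 * (d * (Real.pi / α)) := by
    have hfin : volume (Set.Ioo (-Real.pi) Real.pi ∩ Q) < ⊤ :=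
      lt_of_le_of_lt (measure_mono Set.inter_subset_right) hQf.lt_top
    have h1 := norm_setIntegral_le_of_norm_le_const (C := 1) hfin
      (f := fun θ => oscF ρ (α / Real.pi * θ - β)) (fun θ _ => (oscF_norm _ _).le)
    have h2 := measureReal_mono (μ := volume)
      (Set.inter_subset_right : Set.Ioo (-Real.pi) Real.pi ∩ Q ⊆ Q) hQf
    linarith
  have hα2 := hα.2
  have hβ1 := hβ.1
  have hβ2 := hβ.2
  have g1 := oscF_all ρ d (α - β) hd hrd (by rw [abs_le]; constructor <;> linarith)
  have g2 := oscF_all ρ d (-α - β) hd hrd (by rw [abs_le]; constructor <;> linarith)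
  have hIn : ‖∫ θ in Set.Ioo (-Real.pi) Real.pi, oscF ρ (α / Real.pi * θ - β)‖
      ≤ Real.pi / α * (90 * d) := by
    have hk : 0 < Real.pi / α := by positivity
    rw [hI, norm_smul, Real.norm_eq_abs, abs_of_pos hk]
    gcongr
    refine (norm_sub_le _ _).trans ?_
    linarith
  rw [← eq_sub_iff_add_eq'] at hsplit
  rw [hsplit]
  refine (norm_sub_le _ _).trans ?_
  calc _ ≤ Real.pi / α * (90 * d) + 6 * (d * (Real.pi / α)) := add_le_add hIn hE
    _ = _ := by rw [div_eq_mul_inv]; ring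
end
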